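/- Consider Algorithm 1 run on an n-vertex graph G with maximum degree Δ, and fix π and L. Then every good vertex v (i.e., a vertex with E_{x⃗}[B(v) | π, L] ≤ Δ^{1.4}) satisfies Var(Z_{v,1} | π, L) ≤ C·Δ^{1.4} for a universal constant C, where the conditional variance is over the random vertex partition. -/

import Mathlib

open Finset
open scoped Classical

section Defs

private lemma sym2_exists_mem {V : Type*} (e : Sym2 V) : ∃ a, a ∈ e :=
  ⟨(Quot.out e).1, Sym2.out_fst_mem e⟩

variable {V : Type*} [Fintype V] [DecidableEq V]

/-- The greedy maximal matching of the graph with edge set `E`, processing edges in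
increasing order of the priority function `ρ`: repeatedly pick the minimum-priority
remaining edge, add it to the matching, and discard all edges meeting it. -/
noncomputable def greedyMM {β : Type*} [LinearOrder β] (ρ : Sym2 V → β) (E : Finset (Sym2 V)) :
    Finset (Sym2 V) :=
  if h : E.Nonempty then
    insert (Classical.choose (E.exists_min_image ρ h))
      (greedyMM ρ (E.filter fun f =>
        ¬ ∃ v, v ∈ Classical.choose (E.exists_min_image ρ h) ∧ v ∈ f))
  else ∅
termination_by E.card
decreasing_by
  have he : Classical.choose (E.exists_min_image ρ h) ∈ E :=
    (Classical.choose_spec (E.exists_min_image ρ h)).1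
  apply Finset.card_lt_card
  refine (Finset.ssubset_iff_of_subset (Finset.filter_subset _ _)).2 ⟨_, he, ?_⟩
  intro hmem
  obtain ⟨a, ha⟩ := sym2_exists_mem (Classical.choose (E.exists_min_image ρ h))
  exact (Finset.mem_filter.1 hmem).2 ⟨a, ha, ha⟩

/-- The set of vertices matched by a set `M` of edges. -/
noncomputable def matchedV (M : Finset (Sym2 V)) : Finset V :=
  Finset.univ.filter fun v => ∃ e ∈ M, v ∈ e

/-- Residual degree of `v` with respect to the matching `M` in the graph with edge set `E`:
`0` if `v` is matched, and otherwise the degree of `v` in the induced subgraph on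
unmatched vertices. -/
noncomputable def resDeg (E M : Finset (Sym2 V)) (v : V) : ℕ :=
  if v ∈ matchedV M then 0
  else (E.filter fun e => v ∈ e ∧ ∀ w ∈ e, w ∉ matchedV M).card

/-- The number of vertices whose match-status differs between `M` and `M'`. -/
noncomputable def statusDiff (M M' : Finset (Sym2 V)) : ℕ :=
  (Finset.univ.filter fun v => ¬ (v ∈ matchedV M ↔ v ∈ matchedV M')).card


/-- The endpoints of an edge, as a finset. -/
noncomputable def ends (e : Sym2 V) : Finset V := Finset.univ.filter (· ∈ e)

/-- The recursive edge oracle (with bookkeeping), for the graph with (sampled) edge set `L`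
and priorities `π`, run with the partition-indicator vector `x`.
`eoQ π L x fuel e` returns a triple `(ans, qs, cnt)` where `ans` tells whether `e` joins the
greedy matching of the induced subgraph of `L` on `{v | x v}`, `qs` is the set of entries of
`x` queried, and `cnt` is the number of (recursive) oracle calls made on edges of `L` having
both endpoints in `{v | x v}` (including the call on `e` itself, when applicable).
The oracle first queries the two endpoints of `e` and answers NO if one of them is outside
the part; otherwise it recursively evaluates the incident edges of `L` of smaller priority,
in increasing order of priority, stopping as soon as one of them answers YES.
It is always invoked with `fuel = π e + 1`, which guarantees the fuel never runs out. -/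
noncomputable def eoQ (π : Sym2 V → ℕ) (L : Finset (Sym2 V)) (x : V → Bool) :
    ℕ → Sym2 V → Bool × Finset V × ℕ
  | 0, e => (false, ends e, 0)
  | fuel + 1, e =>
    if ∀ v ∈ e, x v then
      let nbrs := ((L.filter fun f => f ≠ e ∧ (∃ v, v ∈ e ∧ v ∈ f) ∧ π f < π e).toList.mergeSort
          (fun a b => decide (π a ≤ π b)))
      let r := nbrs.foldl (fun (s : Bool × Finset V × ℕ) f =>
          if s.1 then s
          else
            let t := eoQ π L x fuel f
            (t.1, s.2.1 ∪ t.2.1, s.2.2 + t.2.2)) (false, ∅, 0)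
      (!r.1, ends e ∪ r.2.1, (if e ∈ L then 1 else 0) + r.2.2)
    else (false, ends e, 0)

/-- Whether `e` belongs to the greedy matching, as decided by the edge oracle. -/
noncomputable def edgeOracle (π : Sym2 V → ℕ) (L : Finset (Sym2 V)) (x : V → Bool)
    (e : Sym2 V) : Bool × Finset V × ℕ :=
  eoQ π L x (π e + 1) e

/-- The degree oracle for vertex `v`: determines `Z_{v,1}`, the number of neighbors of `v`
(in the graph with edge set `Ed`) lying in the part `{u | x u}` that are unmatched in the
greedy matching of the induced subgraph of `L`.  For each neighbor `u` of `v` it queries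
`x u`, and if `x u = 1`, it runs the edge oracle on every edge of `L` incident to `u`.
Returns `(Z value, set of entries of x queried, number of oracle calls on edges inside the part)`. -/
noncomputable def degOr (Ed : Finset (Sym2 V)) (π : Sym2 V → ℕ) (L : Finset (Sym2 V))
    (x : V → Bool) (v : V) : ℕ × Finset V × ℕ :=
  let Nv := Finset.univ.filter fun u => s(u, v) ∈ Ed
  let q := Nv ∪ (Nv.filter fun u => x u).biUnion fun u =>
      (Finset.univ.filter fun w => s(u, w) ∈ L).biUnion fun w =>
        (edgeOracle π L x s(u, w)).2.1
  let c := ∑ u ∈ Nv.filter (fun u => x u), ∑ w ∈ Finset.univ.filter (fun w => s(u, w) ∈ L),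
        (edgeOracle π L x s(u, w)).2.2
  ((Nv.filter fun u => x u ∧ ∀ w ∈ Finset.univ.filter (fun w => s(u, w) ∈ L),
      (edgeOracle π L x s(u, w)).1 = false).card, q, c)

/-- `B v`: the number of entries of `x` queried during the execution of the degree oracle. -/
noncomputable def Bqueries (Ed : Finset (Sym2 V)) (π : Sym2 V → ℕ) (L : Finset (Sym2 V))
    (x : V → Bool) (v : V) : ℕ :=
  (degOr Ed π L x v).2.1.card

/-- The priority function on edges induced by a permutation `τ` of `Fin E.card`,
via the canonical enumeration of `E`; edges outside `E` get priority `0`. -/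
noncomputable def prioOf (E : Finset (Sym2 V)) (τ : Equiv.Perm (Fin E.card)) (e : Sym2 V) : ℕ :=
  if h : e ∈ E then (τ (E.equivFin ⟨e, h⟩) : ℕ) else 0

/-- `L₁`: the set of edges of `L` with both endpoints inside the part `{v | x v}`. -/
noncomputable def partEdges (L : Finset (Sym2 V)) (x : V → Bool) : Finset (Sym2 V) :=
  L.filter fun e => ∀ v ∈ e, x v

/-- `Z_{v,1}(x)`: the number of neighbors of `v` in the graph `Ed` lying in the part
`{u | x u}` that are unmatched in `M₁ = GreedyMM(L₁, π)`. -/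
noncomputable def Zv1 (Ed : Finset (Sym2 V)) (π : Sym2 V → ℕ) (L : Finset (Sym2 V))
    (x : V → Bool) (v : V) : ℕ :=
  (Finset.univ.filter fun u =>
    s(u, v) ∈ Ed ∧ x u ∧ u ∉ matchedV (greedyMM π (partEdges L x))).card


/-- The matching output by Algorithm 1: the union over all parts `i ∈ [k]` of the greedy
maximal matching (w.r.t. the priorities `π`) of the induced subgraph of the sampled edge
set `L` on the part `V_i = χ⁻¹(i)`. -/
noncomputable def algoMatching (π : Sym2 V → ℕ) (k : ℕ) (χ : V → Fin k)
    (L : Finset (Sym2 V)) : Finset (Sym2 V) :=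
  (Finset.univ : Finset (Fin k)).biUnion fun i =>
    greedyMM π (L.filter fun e => ∀ w ∈ e, χ w = i)

/-- `Z_{v,i}`: the number of neighbors of `v` in the graph `Ed` that lie in part `V_i`
and are unmatched in the matching `M` output by Algorithm 1. -/
noncomputable def Zvi (Ed : Finset (Sym2 V)) (π : Sym2 V → ℕ) (k : ℕ) (χ : V → Fin k)
    (L : Finset (Sym2 V)) (v : V) (i : Fin k) : ℕ :=
  (Finset.univ.filter fun u =>
    s(u, v) ∈ Ed ∧ χ u = i ∧ u ∉ matchedV (algoMatching π k χ L)).card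

/-- `Z'_v`: equal to `Z_{v, χ(v)}` if `v` is unmatched in the output `M` of Algorithm 1,
and `0` if `v` is matched in `M`. -/
noncomputable def Zself (Ed : Finset (Sym2 V)) (π : Sym2 V → ℕ) (k : ℕ) (χ : V → Fin k)
    (L : Finset (Sym2 V)) (v : V) : ℕ :=
  if v ∈ matchedV (algoMatching π k χ L) then 0 else Zvi Ed π k χ L v (χ v)

/-- The Bernoulli product weight of the edge sample `S ⊆ Ed`, each edge kept with
probability `p`. -/
noncomputable def bwE (p : ℝ) (Ed S : Finset (Sym2 V)) : ℝ :=
  p ^ S.card * (1 - p) ^ (Ed.card - S.card)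

/-- The Bernoulli product weight of the indicator vector `x : V → Bool`, each coordinate
equal to `true` independently with probability `q`. -/
noncomputable def bwX (q : ℝ) (x : V → Bool) : ℝ :=
  q ^ (Finset.univ.filter fun v => x v = true).card *
    (1 - q) ^ (Finset.univ.filter fun v => x v = false).card

end Defs

section Oracle

set_option linter.unusedSectionVars false

variable {V : Type*} [Fintype V] [DecidableEq V]

private lemma mem_matchedV {M : Finset (Sym2 V)} {a : V} :
    a ∈ matchedV M ↔ ∃ e ∈ M, a ∈ e := by
  simp [matchedV]

private lemma greedyMM_empty (ρ : Sym2 V → ℕ) : greedyMM ρ (∅ : Finset (Sym2 V)) = ∅ := by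
  rw [greedyMM]; simp

/-- One step of the greedy algorithm, for the unique edge of minimum priority. -/
private lemma greedyMM_of_min (ρ : Sym2 V → ℕ) {F : Finset (Sym2 V)} (hinj : Set.InjOn ρ ↑F)
    {m : Sym2 V} (hm : m ∈ F) (hmin : ∀ f ∈ F, ρ m ≤ ρ f) :
    greedyMM ρ F = insert m (greedyMM ρ (F.filter fun f => ¬ ∃ v, v ∈ m ∧ v ∈ f)) := by
  have h : F.Nonempty := ⟨m, hm⟩
  have hc := Classical.choose_spec (F.exists_min_image ρ h)
  have : Classical.choose (F.exists_min_image ρ h) = m :=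
    hinj hc.1 hm (le_antisymm (hc.2 m hm) (hmin _ hc.1))
  rw [greedyMM, dif_pos h, this]

private lemma filter_disjoint_ssubset {F : Finset (Sym2 V)} {m : Sym2 V} (hm : m ∈ F) :
    (F.filter fun f => ¬ ∃ v, v ∈ m ∧ v ∈ f) ⊂ F := by
  refine (Finset.ssubset_iff_of_subset (Finset.filter_subset _ _)).2 ⟨m, hm, ?_⟩
  intro h
  obtain ⟨a, ha⟩ := sym2_exists_mem m
  exact (Finset.mem_filter.1 h).2 ⟨a, ha, ha⟩

private lemma greedyMM_subset (ρ : Sym2 V → ℕ) (F : Finset (Sym2 V)) (hinj : Set.InjOn ρ ↑F) :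
    greedyMM ρ F ⊆ F := by
  induction F using Finset.strongInduction with
  | H F ih =>
    rcases F.eq_empty_or_nonempty with rfl | h
    · simp [greedyMM_empty]
    · obtain ⟨m, hm, hmin⟩ := F.exists_min_image ρ h
      rw [greedyMM_of_min ρ hinj hm hmin]
      have hs := filter_disjoint_ssubset hm
      refine Finset.insert_subset hm ((ih _ hs (hinj.mono ?_)).trans hs.subset)
      exact_mod_cast hs.subset

/-- An edge joins the greedy matching iff no adjacent edge of smaller priority does. -/
private lemma mem_greedyMM_iff (ρ : Sym2 V → ℕ) (F : Finset (Sym2 V)) (hinj : Set.InjOn ρ ↑F)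
    (e : Sym2 V) :
    e ∈ greedyMM ρ F ↔
      e ∈ F ∧ ∀ f ∈ greedyMM ρ F, (∃ v, v ∈ e ∧ v ∈ f) → ¬ ρ f < ρ e := by
  induction F using Finset.strongInduction with
  | H F ih =>
    rcases F.eq_empty_or_nonempty with rfl | h
    · simp [greedyMM_empty]
    · obtain ⟨m, hm, hmin⟩ := F.exists_min_image ρ h
      have hs := filter_disjoint_ssubset hm
      have hinj' : Set.InjOn ρ ↑(F.filter fun f => ¬ ∃ v, v ∈ m ∧ v ∈ f) :=
        hinj.mono (by exact_mod_cast hs.subset)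
      have ih' := ih _ hs hinj'
      have hsub := greedyMM_subset ρ F hinj
      have hsub' := greedyMM_subset ρ _ hinj'
      rw [greedyMM_of_min ρ hinj hm hmin] at hsub ⊢
      constructor
      · intro he
        refine ⟨hsub he, fun f hf hadj => ?_⟩
        rcases Finset.mem_insert.1 he with rfl | he
        · exact not_lt.2 (hmin f (hsub hf))
        · rcases Finset.mem_insert.1 hf with rfl | hf
          · obtain ⟨a, h1, h2⟩ := hadj
            exact absurd ⟨a, h2, h1⟩ (Finset.mem_filter.1 (hsub' he)).2
          · exact (ih'.1 he).2 f hf hadj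
      · rintro ⟨heF, he⟩
        by_cases hem : e = m
        · exact Finset.mem_insert.2 (Or.inl hem)
        · refine Finset.mem_insert_of_mem (ih'.2 ⟨?_, fun f hf =>
            he f (Finset.mem_insert_of_mem hf)⟩)
          refine Finset.mem_filter.2 ⟨heF, ?_⟩
          rintro ⟨a, h1, h2⟩
          refine he m (Finset.mem_insert_self _ _) ⟨a, h2, h1⟩ ?_
          exact lt_of_le_of_ne (hmin e heF) fun hh => hem (hinj heF hm hh.symm)

/-- Deleting a vertex `u` changes the match-status of at most one vertex besides `u`, and of
no vertex if `u` was unmatched. -/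
private lemma exists_matchedV_greedyMM_delete (ρ : Sym2 V → ℕ) (F : Finset (Sym2 V))
    (hdiag : ∀ e ∈ F, ¬ e.IsDiag) (hinj : Set.InjOn ρ ↑F) (u : V) :
    (u ∉ matchedV (greedyMM ρ F) → ∀ a,
      (a ∈ matchedV (greedyMM ρ F) ↔ a ∈ matchedV (greedyMM ρ (F.filter (u ∉ ·))))) ∧
    ∃ w, ∀ a, a ≠ u → a ≠ w →
      (a ∈ matchedV (greedyMM ρ F) ↔ a ∈ matchedV (greedyMM ρ (F.filter (u ∉ ·)))) := by
  induction F using Finset.strongInduction generalizing u with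
  | H F ih =>
    have key : ∀ (m : Sym2 V) (M : Finset (Sym2 V)) (a : V),
        a ∈ matchedV (insert m M) ↔ a ∈ m ∨ a ∈ matchedV M := by
      intro m M a; simp [mem_matchedV]
    rcases F.eq_empty_or_nonempty with rfl | h
    · simpa using ⟨u⟩
    · obtain ⟨m, hm, hmin⟩ := F.exists_min_image ρ h
      have hs := filter_disjoint_ssubset hm
      by_cases hu : u ∈ m
      · obtain ⟨w, rfl⟩ := Sym2.mem_iff_exists.1 hu
        have hs' : F.filter (u ∉ ·) ⊂ F := by
          refine (Finset.ssubset_iff_of_subset (Finset.filter_subset _ _)).2 ⟨_, hm, ?_⟩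
          simp
        have hinj' : Set.InjOn ρ ↑(F.filter (u ∉ ·)) :=
          hinj.mono (by exact_mod_cast hs'.subset)
        obtain ⟨h1, w', h2⟩ := ih _ hs' (fun e he => hdiag e (hs'.subset he)) hinj' w
        have heq : (F.filter (u ∉ ·)).filter (w ∉ ·) =
            F.filter fun f => ¬ ∃ v, v ∈ s(u, w) ∧ v ∈ f := by
          ext f; simp [and_assoc]
        rw [heq] at h1 h2
        rw [greedyMM_of_min ρ hinj hm hmin]
        refine ⟨fun hn => absurd ((key _ _ _).2 (Or.inl hu)) hn, ?_⟩
        by_cases hw : w ∈ matchedV (greedyMM ρ (F.filter (u ∉ ·)))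
        · refine ⟨w', fun a hau haw => ?_⟩
          rw [key]
          by_cases haw' : a = w
          · subst haw'; simp [hw]
          · rw [h2 a haw' haw]; simp [hau, haw']
        · refine ⟨w, fun a hau haw => ?_⟩
          rw [key, h1 hw a]; simp [hau, haw]
      · have hm' : m ∈ F.filter (u ∉ ·) := Finset.mem_filter.2 ⟨hm, hu⟩
        have hinj' : Set.InjOn ρ ↑(F.filter (u ∉ ·)) :=
          hinj.mono (by exact_mod_cast Finset.filter_subset _ _)
        have hinj'' : Set.InjOn ρ ↑(F.filter fun f => ¬ ∃ v, v ∈ m ∧ v ∈ f) :=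
          hinj.mono (by exact_mod_cast hs.subset)
        obtain ⟨h1, w', h2⟩ := ih _ hs (fun e he => hdiag e (hs.subset he)) hinj'' u
        rw [greedyMM_of_min ρ hinj hm hmin, greedyMM_of_min ρ hinj' hm'
          (fun f hf => hmin f (Finset.mem_filter.1 hf).1), Finset.filter_comm]
        refine ⟨fun hn a => ?_, w', fun a hau haw => ?_⟩
        · rw [key, key, h1 (fun hh => hn ((key _ _ _).2 (Or.inr hh))) a]
        · rw [key, key, h2 a hau haw]

/-- The loop of the edge oracle over a list of edges. -/
private noncomputable def oracleLoop (g : Sym2 V → Bool × Finset V × ℕ) (l : List (Sym2 V))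
    (s : Bool × Finset V × ℕ) : Bool × Finset V × ℕ :=
  l.foldl (fun (s : Bool × Finset V × ℕ) f =>
    if s.1 then s else
      let t := g f
      (t.1, s.2.1 ∪ t.2.1, s.2.2 + t.2.2)) s

private lemma oracleLoop_cons (g : Sym2 V → Bool × Finset V × ℕ) (f : Sym2 V)
    (l : List (Sym2 V)) (s : Bool × Finset V × ℕ) :
    oracleLoop g (f :: l) s = oracleLoop g l
      (if s.1 then s else ((g f).1, s.2.1 ∪ (g f).2.1, s.2.2 + (g f).2.2)) := rfl

private lemma oracleLoop_fst (g : Sym2 V → Bool × Finset V × ℕ) (l : List (Sym2 V))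
    (s : Bool × Finset V × ℕ) :
    (oracleLoop g l s).1 = true ↔ s.1 = true ∨ ∃ f ∈ l, (g f).1 = true := by
  induction l generalizing s with
  | nil => simp [oracleLoop]
  | cons f l ih =>
    rw [oracleLoop_cons, ih]
    by_cases hs : s.1 = true <;> simp [hs]

private lemma subset_oracleLoop (g : Sym2 V → Bool × Finset V × ℕ) (l : List (Sym2 V))
    (s : Bool × Finset V × ℕ) : s.2.1 ⊆ (oracleLoop g l s).2.1 := by
  induction l generalizing s with
  | nil => simp [oracleLoop]
  | cons f l ih =>
    rw [oracleLoop_cons]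
    refine subset_trans ?_ (ih _)
    by_cases hs : s.1 = true <;> simp [hs]

private lemma oracleLoop_congr (x x' : V → Bool) (g g' : Sym2 V → Bool × Finset V × ℕ)
    (l : List (Sym2 V)) (hg : ∀ f, (∀ a ∈ (g f).2.1, x a = x' a) → g f = g' f)
    (s : Bool × Finset V × ℕ) (h : ∀ a ∈ (oracleLoop g l s).2.1, x a = x' a) :
    oracleLoop g l s = oracleLoop g' l s := by
  induction l generalizing s with
  | nil => rfl
  | cons f l ih =>
    rw [oracleLoop_cons] at h ⊢
    rw [oracleLoop_cons]
    by_cases hs : s.1 = true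
    · simp only [hs, if_true] at h ⊢
      exact ih _ h
    · simp only [hs] at h ⊢
      have : g f = g' f := hg f fun a ha => h a (subset_oracleLoop _ _ _ (by simp [ha]))
      rw [← this]
      exact ih _ h

/-- The smaller-priority neighbors of `e` in `L`, sorted by priority. -/
private noncomputable def lowerNbrs (π : Sym2 V → ℕ) (L : Finset (Sym2 V)) (e : Sym2 V) :
    List (Sym2 V) :=
  (L.filter fun f => f ≠ e ∧ (∃ v, v ∈ e ∧ v ∈ f) ∧ π f < π e).toList.mergeSort
    (fun a b => decide (π a ≤ π b))

private lemma mem_lowerNbrs {π : Sym2 V → ℕ} {L : Finset (Sym2 V)} {e f : Sym2 V} :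
    f ∈ lowerNbrs π L e ↔ f ∈ L ∧ f ≠ e ∧ (∃ v, v ∈ e ∧ v ∈ f) ∧ π f < π e := by
  simp [lowerNbrs]

private lemma eoQ_succ_pos (π : Sym2 V → ℕ) (L : Finset (Sym2 V)) (x : V → Bool) (n : ℕ)
    (e : Sym2 V) (h : ∀ v ∈ e, x v = true) :
    eoQ π L x (n + 1) e =
      (!(oracleLoop (eoQ π L x n) (lowerNbrs π L e) (false, ∅, 0)).1,
        ends e ∪ (oracleLoop (eoQ π L x n) (lowerNbrs π L e) (false, ∅, 0)).2.1,
        (if e ∈ L then 1 else 0) +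
          (oracleLoop (eoQ π L x n) (lowerNbrs π L e) (false, ∅, 0)).2.2) := by
  rw [eoQ, if_pos h]; rfl

private lemma eoQ_succ_neg (π : Sym2 V → ℕ) (L : Finset (Sym2 V)) (x : V → Bool) (n : ℕ)
    (e : Sym2 V) (h : ¬ ∀ v ∈ e, x v = true) :
    eoQ π L x (n + 1) e = (false, ends e, 0) := by
  rw [eoQ, if_neg h]

/-- The run of the edge oracle depends only on the queried entries. -/
private lemma eoQ_congr (π : Sym2 V → ℕ) (L : Finset (Sym2 V)) (x x' : V → Bool) (n : ℕ)
    (e : Sym2 V) (h : ∀ a ∈ (eoQ π L x n e).2.1, x a = x' a) :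
    eoQ π L x n e = eoQ π L x' n e := by
  induction n generalizing e with
  | zero => simp [eoQ]
  | succ n ih =>
    by_cases hx : ∀ v ∈ e, x v = true
    · rw [eoQ_succ_pos π L x n e hx] at h ⊢
      have hneg : ∀ v ∈ e, x' v = true := fun v hv => by
        rw [← h v (by simp [ends, hv])]; exact hx v hv
      rw [eoQ_succ_pos π L x' n e hneg, oracleLoop_congr x x' (eoQ π L x n) (eoQ π L x' n) _ ih _
        fun a ha => h a (by simp [ha])]
    · rw [eoQ_succ_neg π L x n e hx] at h ⊢
      have hneg : ¬ ∀ v ∈ e, x' v = true := fun hh => hx fun v hv => by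
        rw [h v (by simp [ends, hv])]; exact hh v hv
      rw [eoQ_succ_neg π L x' n e hneg]

/-- The edge oracle decides membership in the greedy matching. -/
private lemma eoQ_fst_iff (π : Sym2 V → ℕ) (L : Finset (Sym2 V)) (hinj : Set.InjOn π ↑L)
    (x : V → Bool) (n : ℕ) (e : Sym2 V) (he : e ∈ L) (hn : π e < n) :
    (eoQ π L x n e).1 = true ↔ e ∈ greedyMM π (partEdges L x) := by
  have hinj' : Set.InjOn π ↑(partEdges L x) :=
    hinj.mono (by exact_mod_cast Finset.filter_subset _ _)
  induction n generalizing e with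
  | zero => omega
  | succ n ih =>
    rw [mem_greedyMM_iff π _ hinj']
    by_cases hx : ∀ v ∈ e, x v = true
    · rw [eoQ_succ_pos π L x n e hx]
      have hloop := oracleLoop_fst (eoQ π L x n) (lowerNbrs π L e) (false, ∅, 0)
      simp only [Bool.not_eq_true', ← Bool.not_eq_true, hloop]
      have hep : e ∈ partEdges L x := Finset.mem_filter.2 ⟨he, hx⟩
      constructor
      · intro h
        refine ⟨hep, fun f hf hadj hlt => h (Or.inr ⟨f, ?_, ?_⟩)⟩
        · have hfL := (Finset.mem_filter.1 (greedyMM_subset π _ hinj' hf)).1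
          exact mem_lowerNbrs.2 ⟨hfL, fun hh => by simp [hh] at hlt, hadj, hlt⟩
        · have hfL := (Finset.mem_filter.1 (greedyMM_subset π _ hinj' hf)).1
          exact (ih f hfL (by omega)).2 hf
      · rintro ⟨-, h⟩ (h0 | ⟨f, hf, hft⟩)
        · simp at h0
        · obtain ⟨hfL, -, hadj, hlt⟩ := mem_lowerNbrs.1 hf
          exact h f ((ih f hfL (by omega)).1 hft) hadj hlt
    · rw [eoQ_succ_neg π L x n e hx]
      have hep : e ∉ partEdges L x := fun hh => hx (Finset.mem_filter.1 hh).2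
      simp [hep]

private lemma Zv1_eq_degOr (E : Finset (Sym2 V)) (π : Sym2 V → ℕ) (L : Finset (Sym2 V))
    (hinj : Set.InjOn π ↑L) (x : V → Bool) (v : V) :
    Zv1 E π L x v = (degOr E π L x v).1 := by
  have hinj' : Set.InjOn π ↑(partEdges L x) :=
    hinj.mono (by exact_mod_cast Finset.filter_subset _ _)
  have key : ∀ u, u ∉ matchedV (greedyMM π (partEdges L x)) ↔
      ∀ w, s(u, w) ∈ L → (edgeOracle π L x s(u, w)).1 = false := by
    intro u
    rw [mem_matchedV]
    constructor
    · intro h w hw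
      rw [← Bool.not_eq_true, edgeOracle, eoQ_fst_iff π L hinj x _ _ hw (Nat.lt_succ_self _)]
      exact fun hm => h ⟨_, hm, Sym2.mem_mk_left u w⟩
    · rintro h ⟨e, he, hu⟩
      obtain ⟨w, rfl⟩ := Sym2.mem_iff_exists.1 hu
      have hw : s(u, w) ∈ L := (Finset.mem_filter.1 (greedyMM_subset π _ hinj' he)).1
      have := h w hw
      rw [← Bool.not_eq_true, edgeOracle, eoQ_fst_iff π L hinj x _ _ hw
        (Nat.lt_succ_self _)] at this
      exact this he
  rw [Zv1, degOr]
  refine congrArg Finset.card ?_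
  ext u
  simp [key u]

/-- The entries of `x` queried by the degree oracle. -/
private noncomputable def queriedSet (E : Finset (Sym2 V)) (π : Sym2 V → ℕ)
    (L : Finset (Sym2 V)) (x : V → Bool) (v : V) : Finset V :=
  (degOr E π L x v).2.1

private lemma Zv1_congr (E : Finset (Sym2 V)) (π : Sym2 V → ℕ) (L : Finset (Sym2 V))
    (hinj : Set.InjOn π ↑L) (x x' : V → Bool) (v : V)
    (h : ∀ a ∈ queriedSet E π L x v, x a = x' a) : Zv1 E π L x v = Zv1 E π L x' v := by
  rw [Zv1_eq_degOr E π L hinj, Zv1_eq_degOr E π L hinj, degOr, degOr]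
  refine congrArg Finset.card (Finset.filter_congr fun u hu => ?_)
  have hxu : x u = x' u := h u (by
    unfold queriedSet degOr
    exact Finset.mem_union_left _ hu)
  rw [hxu]
  refine and_congr_right fun hxu' => ?_
  refine forall_congr' fun w => forall_congr' fun hw => ?_
  rw [edgeOracle, edgeOracle, eoQ_congr π L x x' _ _ fun a ha => h a ?_]
  unfold queriedSet degOr
  refine Finset.mem_union_right _ (Finset.mem_biUnion.2 ⟨u, ?_, Finset.mem_biUnion.2 ⟨w, hw, ha⟩⟩)
  exact Finset.mem_filter.2 ⟨hu, hxu.trans hxu'⟩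

end Oracle

section EfronStein

set_option linter.unusedSectionVars false

variable {V : Type*} [Fintype V] [DecidableEq V]

/-- Flip the coordinate `v` of `x`. -/
private def flipAt (v : V) (x : V → Bool) : V → Bool := Function.update x v (!x v)

private lemma flipAt_same (v : V) (x : V → Bool) : flipAt v x v = !x v := by simp [flipAt]

private lemma flipAt_ne {u v : V} (h : u ≠ v) (x : V → Bool) : flipAt v x u = x u := by
  simp [flipAt, h]

private lemma flipAt_flipAt (v : V) (x : V → Bool) : flipAt v (flipAt v x) = x := by
  ext u; by_cases h : u = v
  · subst h; simp [flipAt]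
  · simp [flipAt, h]

private lemma flipAt_comm (u v : V) (x : V → Bool) :
    flipAt u (flipAt v x) = flipAt v (flipAt u x) := by
  by_cases huv : u = v
  · rw [huv]
  · ext a
    by_cases h1 : a = u
    · subst h1; simp [flipAt_same, flipAt_ne huv]
    · by_cases h2 : a = v
      · subst h2; simp [flipAt_same, flipAt_ne h1]
      · simp [flipAt_ne h1, flipAt_ne h2]

private lemma sum_flipAt (v : V) (F : (V → Bool) → ℝ) : ∑ x, F (flipAt v x) = ∑ x, F x :=
  Equiv.sum_comp (Function.Involutive.toPerm (flipAt v) (flipAt_flipAt v)) F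

/-- The Bernoulli weight of one coordinate. -/
private noncomputable def coinWeight (q : ℝ) (b : Bool) : ℝ := if b then q else 1 - q

private lemma coinWeight_add (q : ℝ) (b : Bool) : coinWeight q b + coinWeight q (!b) = 1 := by
  cases b <;> simp [coinWeight]

private lemma bwX_eq_prod (q : ℝ) (x : V → Bool) : bwX q x = ∏ v, coinWeight q (x v) := by
  simp only [bwX, coinWeight]
  rw [Finset.prod_ite]
  simp

private lemma sum_bwX (q : ℝ) : ∑ x : V → Bool, bwX q x = 1 := by
  simp only [bwX_eq_prod]
  have := (Finset.prod_univ_sum (fun _ : V => (Finset.univ : Finset Bool))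
    (fun _ b => coinWeight q b))
  rw [Fintype.piFinset_univ] at this
  rw [← this]
  simp [coinWeight]

private lemma bwX_nonneg {q : ℝ} (h0 : 0 ≤ q) (h1 : q ≤ 1) (x : V → Bool) : 0 ≤ bwX q x := by
  have : 0 ≤ 1 - q := by linarith
  unfold bwX; positivity

private lemma bwX_flipAt (q : ℝ) (v : V) (x : V → Bool) :
    bwX q x * coinWeight q (!x v) = bwX q (flipAt v x) * coinWeight q (x v) := by
  rw [bwX_eq_prod, bwX_eq_prod, ← Finset.mul_prod_erase _ _ (Finset.mem_univ v),
    ← Finset.mul_prod_erase _ (fun u => coinWeight q (flipAt v x u)) (Finset.mem_univ v),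
    flipAt_same]
  have : ∏ u ∈ Finset.univ.erase v, coinWeight q (flipAt v x u) =
      ∏ u ∈ Finset.univ.erase v, coinWeight q (x u) :=
    Finset.prod_congr rfl fun u hu => by rw [flipAt_ne (Finset.ne_of_mem_erase hu)]
  rw [this]; ring

/-- Expectation under the Bernoulli product weight. -/
private noncomputable def bernoulliExp (q : ℝ) (f : (V → Bool) → ℝ) : ℝ := ∑ x, bwX q x * f x

/-- Resample the coordinate `v` (conditional expectation given all other coordinates). -/
private noncomputable def avgAt (q : ℝ) (v : V) (f : (V → Bool) → ℝ) (x : V → Bool) : ℝ :=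
  coinWeight q (x v) * f x + coinWeight q (!x v) * f (flipAt v x)

private lemma avgAt_flipAt (q : ℝ) (v : V) (f : (V → Bool) → ℝ) (x : V → Bool) :
    avgAt q v f (flipAt v x) = avgAt q v f x := by
  simp only [avgAt, flipAt_same, flipAt_flipAt, Bool.not_not]; ring

private lemma avgAt_comm (q : ℝ) (u v : V) (f : (V → Bool) → ℝ) :
    avgAt q u (avgAt q v f) = avgAt q v (avgAt q u f) := by
  by_cases h : u = v
  · rw [h]
  · ext x
    simp only [avgAt, flipAt_ne h, flipAt_ne (Ne.symm h), flipAt_comm u v]; ring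

private lemma avgAt_sub (q : ℝ) (v : V) (f g : (V → Bool) → ℝ) :
    avgAt q v (f - g) = avgAt q v f - avgAt q v g := by
  ext x; simp only [avgAt, Pi.sub_apply]; ring

private lemma bernoulliExp_avgAt (q : ℝ) (v : V) (f : (V → Bool) → ℝ) :
    bernoulliExp q (avgAt q v f) = bernoulliExp q f := by
  have h : ∑ x, bwX q x * (coinWeight q (!x v) * f (flipAt v x)) =
      ∑ x, bwX q x * (coinWeight q (!x v) * f x) := by
    rw [← sum_flipAt v (fun x => bwX q x * (coinWeight q (!x v) * f x))]
    refine Finset.sum_congr rfl fun x _ => ?_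
    rw [flipAt_same, Bool.not_not, ← mul_assoc, ← mul_assoc, bwX_flipAt]
  simp only [bernoulliExp, avgAt, mul_add, Finset.sum_add_distrib, h]
  rw [← Finset.sum_add_distrib]
  refine Finset.sum_congr rfl fun x _ => ?_
  linear_combination (bwX q x * f x) * coinWeight_add q (x v)

private lemma bernoulliExp_sq_sub_avgAt (q : ℝ) (v : V) (f : (V → Bool) → ℝ) :
    bernoulliExp q (fun x => (f x - avgAt q v f x) ^ 2) =
      bernoulliExp q (fun x => f x ^ 2) - bernoulliExp q (fun x => avgAt q v f x ^ 2) := by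
  have h : bernoulliExp q (fun x => f x * avgAt q v f x) = bernoulliExp q (fun x => avgAt q v f x ^ 2) := by
    rw [← bernoulliExp_avgAt q v]
    congr 1
    ext x
    conv_lhs => rw [avgAt]
    simp only [avgAt_flipAt]
    rw [sq]
    nth_rewrite 3 [avgAt]
    ring
  have h2 : bernoulliExp q (fun x => (f x - avgAt q v f x) ^ 2) =
      bernoulliExp q (fun x => f x ^ 2) - 2 * bernoulliExp q (fun x => f x * avgAt q v f x) +
        bernoulliExp q (fun x => avgAt q v f x ^ 2) := by
    simp only [bernoulliExp, Finset.mul_sum]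
    rw [← Finset.sum_sub_distrib, ← Finset.sum_add_distrib]
    exact Finset.sum_congr rfl fun x _ => by ring
  rw [h2, h]; ring

private lemma bernoulliExp_nonneg {q : ℝ} (h0 : 0 ≤ q) (h1 : q ≤ 1) {f : (V → Bool) → ℝ}
    (hf : ∀ x, 0 ≤ f x) : 0 ≤ bernoulliExp q f :=
  Finset.sum_nonneg fun x _ => mul_nonneg (bwX_nonneg h0 h1 x) (hf x)

/-- Resample all coordinates in a list. -/
private noncomputable def avgList (q : ℝ) (l : List V) (f : (V → Bool) → ℝ) : (V → Bool) → ℝ :=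
  l.foldr (avgAt q) f

private lemma avgList_cons (q : ℝ) (v : V) (l : List V) (f : (V → Bool) → ℝ) :
    avgList q (v :: l) f = avgAt q v (avgList q l f) := rfl

private lemma avgAt_avgList (q : ℝ) (v : V) (l : List V) (f : (V → Bool) → ℝ) :
    avgAt q v (avgList q l f) = avgList q l (avgAt q v f) := by
  induction l with
  | nil => rfl
  | cons u l ih => rw [avgList_cons, avgList_cons, avgAt_comm, ih]

private lemma avgList_sub (q : ℝ) (l : List V) (f g : (V → Bool) → ℝ) :
    avgList q l (f - g) = avgList q l f - avgList q l g := by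
  induction l with
  | nil => rfl
  | cons u l ih => simp only [avgList_cons, ih, avgAt_sub]

private lemma bernoulliExp_avgList (q : ℝ) (l : List V) (f : (V → Bool) → ℝ) :
    bernoulliExp q (avgList q l f) = bernoulliExp q f := by
  induction l with
  | nil => rfl
  | cons u l ih => rw [avgList_cons, bernoulliExp_avgAt, ih]

private lemma bernoulliExp_avgList_sq_le {q : ℝ} (h0 : 0 ≤ q) (h1 : q ≤ 1) (l : List V)
    (f : (V → Bool) → ℝ) :
    bernoulliExp q (fun x => avgList q l f x ^ 2) ≤ bernoulliExp q (fun x => f x ^ 2) := by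
  induction l with
  | nil => exact le_rfl
  | cons u l ih =>
    have h := bernoulliExp_sq_sub_avgAt q u (avgList q l f)
    have h' := bernoulliExp_nonneg h0 h1 (f := fun x => (avgList q l f x - avgAt q u (avgList q l f) x) ^ 2)
      fun x => sq_nonneg _
    rw [avgList_cons]
    linarith

private lemma bernoulliExp_sq_sub_avgList_le {q : ℝ} (h0 : 0 ≤ q) (h1 : q ≤ 1) (l : List V)
    (f : (V → Bool) → ℝ) :
    bernoulliExp q (fun x => f x ^ 2) - bernoulliExp q (fun x => avgList q l f x ^ 2) ≤
      (l.map fun v => bernoulliExp q (fun x => (f x - avgAt q v f x) ^ 2)).sum := by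
  induction l with
  | nil => simp [avgList]
  | cons u l ih =>
    have h := bernoulliExp_sq_sub_avgAt q u (avgList q l f)
    have h' := bernoulliExp_avgList_sq_le h0 h1 l (f - avgAt q u f)
    rw [avgList_sub, ← avgAt_avgList] at h'
    simp only [Pi.sub_apply] at h'
    rw [avgList_cons, List.map_cons, List.sum_cons]
    linarith

private lemma avgList_flipAt (q : ℝ) {v : V} {l : List V} (hv : v ∈ l) (f : (V → Bool) → ℝ)
    (x : V → Bool) : avgList q l f (flipAt v x) = avgList q l f x := by
  induction l generalizing x with
  | nil => simp at hv
  | cons u l ih =>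
    rw [avgList_cons]
    by_cases huv : u = v
    · rw [huv, avgAt_flipAt]
    · have hl : v ∈ l := by
        rcases List.mem_cons.1 hv with h | h
        · exact absurd h.symm huv
        · exact h
      simp only [avgAt, flipAt_ne huv, flipAt_comm u v, ih hl]

private lemma eq_of_flipAt_invariant {g : (V → Bool) → ℝ}
    (hg : ∀ v x, g (flipAt v x) = g x) (x y : V → Bool) : g x = g y := by
  have hupd : ∀ v x b, g (Function.update x v b) = g x := by
    intro v x b
    by_cases h : b = x v
    · rw [h, Function.update_eq_self]
    · rw [Bool.eq_not_of_ne h]; exact hg v x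
  have : ∀ S : Finset V, g (S.piecewise y x) = g x := by
    intro S
    induction S using Finset.induction_on with
    | empty => simp
    | insert a S _ ih => rw [Finset.piecewise_insert, hupd, ih]
  rw [← this Finset.univ, Finset.piecewise_univ]

/-- The Efron–Stein inequality for Bernoulli product weights. -/
private lemma bernoulliExp_variance_le {q : ℝ} (h0 : 0 ≤ q) (h1 : q ≤ 1) (f : (V → Bool) → ℝ) :
    bernoulliExp q (fun x => (f x - bernoulliExp q f) ^ 2) ≤
      ∑ v, bernoulliExp q (fun x => (f x - avgAt q v f x) ^ 2) := by
  have hconst : ∀ x, avgList q Finset.univ.toList f x = bernoulliExp q f := by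
    intro x
    have hc : ∀ y, avgList q Finset.univ.toList f y = avgList q Finset.univ.toList f x :=
      fun y => eq_of_flipAt_invariant
        (fun v z => avgList_flipAt q (by simp) f z) y x
    rw [← bernoulliExp_avgList q Finset.univ.toList f]
    simp only [bernoulliExp, hc]
    rw [← Finset.sum_mul, sum_bwX, one_mul]
  have hmain := bernoulliExp_sq_sub_avgList_le h0 h1 Finset.univ.toList f
  simp only [hconst] at hmain
  rw [Finset.sum_map_toList] at hmain
  refine le_trans (le_of_eq ?_) hmain
  have hb := sum_bwX (V := V) q
  have e1 : bernoulliExp q (fun x => (f x - bernoulliExp q f) ^ 2) =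
      bernoulliExp q (fun x => f x ^ 2) - 2 * bernoulliExp q f * bernoulliExp q f +
        bernoulliExp q f ^ 2 * ∑ x : V → Bool, bwX q x := by
    generalize hm : bernoulliExp q f = m
    have : 2 * m * m = 2 * m * bernoulliExp q f := by rw [hm]
    rw [this]
    simp only [bernoulliExp, Finset.mul_sum]
    rw [← Finset.sum_sub_distrib, ← Finset.sum_add_distrib]
    exact Finset.sum_congr rfl fun x _ => by ring
  have e2 : bernoulliExp q (fun _ : V → Bool => bernoulliExp q f ^ 2) = bernoulliExp q f ^ 2 := by
    rw [bernoulliExp, ← Finset.sum_mul, hb, one_mul]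
  rw [e1, e2, hb]; ring

end EfronStein

section Variance

variable {V : Type*} [Fintype V] [DecidableEq V]

/-- Moving one vertex out of the part changes `Z_{v,1}` by at most two. -/
private lemma abs_Zv1_sub_flipAt_of_mem_le (E : Finset (Sym2 V)) (hdiag : ∀ e ∈ E, ¬ e.IsDiag)
    (π : Sym2 V → ℕ) (hinj : Set.InjOn π ↑E) (L : Finset (Sym2 V)) (hL : L ⊆ E)
    (v u : V) (x : V → Bool) (hx : x u = true) :
    |(Zv1 E π L x v : ℝ) - Zv1 E π L (flipAt u x) v| ≤ 2 := by
  have hsub : partEdges L x ⊆ E := (Finset.filter_subset _ _).trans hL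
  have hpart : partEdges L (flipAt u x) = (partEdges L x).filter (u ∉ ·) := by
    ext e
    simp only [partEdges, Finset.mem_filter, and_assoc]
    refine and_congr_right fun _ => ⟨fun h => ?_, fun h w hw => ?_⟩
    · have hu : u ∉ e := fun hu => by simpa [flipAt_same, hx] using h u hu
      refine ⟨fun w hw => ?_, hu⟩
      rw [← flipAt_ne (u := w) (v := u) (fun hh => hu (hh ▸ hw)) x]
      exact h w hw
    · rw [flipAt_ne fun hh : w = u => h.2 (hh ▸ hw)]
      exact h.1 w hw
  obtain ⟨-, w, hw⟩ := exists_matchedV_greedyMM_delete π (partEdges L x)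
    (fun e he => hdiag e (hsub he)) (hinj.mono (by exact_mod_cast hsub)) u
  rw [← hpart] at hw
  have hiff : ∀ a, a ≠ u → a ≠ w →
      ((s(a, v) ∈ E ∧ x a = true ∧ a ∉ matchedV (greedyMM π (partEdges L x))) ↔
      (s(a, v) ∈ E ∧ flipAt u x a = true ∧
        a ∉ matchedV (greedyMM π (partEdges L (flipAt u x))))) := by
    intro a hau haw
    rw [hw a hau haw, flipAt_ne hau]
  have hcard : ({u, w} : Finset V).card ≤ 2 := Finset.card_le_two
  have hle : ∀ P Q : V → Prop, (∀ a, a ≠ u → a ≠ w → (P a → Q a)) →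
      (Finset.univ.filter P).card ≤ (Finset.univ.filter Q).card + 2 := by
    intro P Q h
    refine le_trans (Finset.card_le_card (t := Finset.univ.filter Q ∪ {u, w}) ?_)
      ((Finset.card_union_le _ _).trans (by omega))
    intro a ha
    by_cases hau : a = u
    · simp [hau]
    · by_cases haw : a = w
      · simp [haw]
      · simp only [Finset.mem_filter, Finset.mem_univ, true_and] at ha
        simp [h a hau haw ha]
  have hA : Zv1 E π L x v ≤ Zv1 E π L (flipAt u x) v + 2 := by
    unfold Zv1
    convert hle _ _ fun a h1 h2 => (hiff a h1 h2).1
  have hB : Zv1 E π L (flipAt u x) v ≤ Zv1 E π L x v + 2 := by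
    unfold Zv1
    convert hle _ _ fun a h1 h2 => (hiff a h1 h2).2
  have hA' : (Zv1 E π L x v : ℝ) ≤ Zv1 E π L (flipAt u x) v + 2 := by exact_mod_cast hA
  have hB' : (Zv1 E π L (flipAt u x) v : ℝ) ≤ Zv1 E π L x v + 2 := by exact_mod_cast hB
  rw [abs_le]; constructor <;> linarith

private lemma abs_Zv1_sub_flipAt_le (E : Finset (Sym2 V)) (hdiag : ∀ e ∈ E, ¬ e.IsDiag)
    (π : Sym2 V → ℕ) (hinj : Set.InjOn π ↑E) (L : Finset (Sym2 V)) (hL : L ⊆ E)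
    (v u : V) (x : V → Bool) :
    |(Zv1 E π L x v : ℝ) - Zv1 E π L (flipAt u x) v| ≤ 2 := by
  by_cases hx : x u = true
  · exact abs_Zv1_sub_flipAt_of_mem_le E hdiag π hinj L hL v u x hx
  · have h := abs_Zv1_sub_flipAt_of_mem_le E hdiag π hinj L hL v u (flipAt u x)
      (by simp [flipAt_same, hx])
    rwa [flipAt_flipAt, abs_sub_comm] at h

private lemma sq_Zv1_sub_avgAt_le (E : Finset (Sym2 V)) (hdiag : ∀ e ∈ E, ¬ e.IsDiag)
    (π : Sym2 V → ℕ) (hinj : Set.InjOn π ↑E) (L : Finset (Sym2 V)) (hL : L ⊆ E)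
    {q : ℝ} (h0 : 0 ≤ q) (h1 : q ≤ 1) (v u : V) (x : V → Bool) :
    ((Zv1 E π L x v : ℝ) - avgAt q u (fun y => (Zv1 E π L y v : ℝ)) x) ^ 2 ≤
      4 * if u ∈ queriedSet E π L x v then 1 else 0 := by
  have heq : (Zv1 E π L x v : ℝ) - avgAt q u (fun y => (Zv1 E π L y v : ℝ)) x =
      coinWeight q (!x u) * ((Zv1 E π L x v : ℝ) - Zv1 E π L (flipAt u x) v) := by
    simp only [avgAt]
    linear_combination -(Zv1 E π L x v : ℝ) * coinWeight_add q (x u)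
  rw [heq, mul_pow]
  split_ifs with hu
  · have hd := abs_Zv1_sub_flipAt_le E hdiag π hinj L hL v u x
    have hd2 : ((Zv1 E π L x v : ℝ) - Zv1 E π L (flipAt u x) v) ^ 2 ≤ 2 ^ 2 :=
      sq_le_sq' (abs_le.1 hd).1 (abs_le.1 hd).2
    have hc0 : 0 ≤ coinWeight q (!x u) := by unfold coinWeight; split_ifs <;> linarith
    have hc1 : coinWeight q (!x u) ≤ 1 := by unfold coinWeight; split_ifs <;> linarith
    have hc2 : coinWeight q (!x u) ^ 2 ≤ 1 := pow_le_one₀ hc0 hc1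
    nlinarith [sq_nonneg ((Zv1 E π L x v : ℝ) - Zv1 E π L (flipAt u x) v)]
  · have hZ : Zv1 E π L x v = Zv1 E π L (flipAt u x) v :=
      Zv1_congr E π L (hinj.mono (by exact_mod_cast hL)) x _ v fun a ha =>
        (flipAt_ne (fun hh : a = u => hu (hh ▸ ha)) x).symm
    simp [← hZ]

private lemma bernoulliExp_variance_Zv1_le (E : Finset (Sym2 V)) (hdiag : ∀ e ∈ E, ¬ e.IsDiag)
    (π : Sym2 V → ℕ) (hinj : Set.InjOn π ↑E) (L : Finset (Sym2 V)) (hL : L ⊆ E)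
    {q : ℝ} (h0 : 0 ≤ q) (h1 : q ≤ 1) (v : V) :
    bernoulliExp q (fun x => ((Zv1 E π L x v : ℝ) - bernoulliExp q fun y => (Zv1 E π L y v : ℝ)) ^ 2) ≤
      4 * bernoulliExp q (fun x => (Bqueries E π L x v : ℝ)) := by
  refine (bernoulliExp_variance_le h0 h1 fun x => (Zv1 E π L x v : ℝ)).trans ?_
  have hB : ∀ x, (Bqueries E π L x v : ℝ) =
      ∑ u, if u ∈ queriedSet E π L x v then (1 : ℝ) else 0 := by
    intro x
    rw [Finset.sum_boole, Finset.filter_univ_mem]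
    rfl
  calc _ ≤ ∑ u, bernoulliExp q (fun x => 4 * if u ∈ queriedSet E π L x v then (1 : ℝ) else 0) :=
        Finset.sum_le_sum fun u _ => Finset.sum_le_sum fun x _ =>
          mul_le_mul_of_nonneg_left (sq_Zv1_sub_avgAt_le E hdiag π hinj L hL h0 h1 v u x)
            (bwX_nonneg h0 h1 x)
    _ = _ := by
        simp only [bernoulliExp, hB, Finset.mul_sum]
        rw [Finset.sum_comm]
        exact Finset.sum_congr rfl fun x _ => Finset.sum_congr rfl fun u _ => by ring

end Variance

universe u

/-- **Good vertices have small variance** (Claim 4.9).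
There is a universal constant `C > 0` such that the following holds.  Run Algorithm 1 on a
graph `G = (V, E)` with maximum degree `Δ` (edge-sampling probability `p = Δ^{-0.85}`,
`k = Δ^{0.1}` parts), and fix the permutation `π` and the edge sample `L`.  Then every
*good* vertex `v` — i.e. one with `E_{x⃗}[B(v) ∣ π, L] ≤ Δ^{1.4}`, the expectation being
over the indicator vector `x⃗` of `V₁`, with i.i.d. Bernoulli-`1/k` coordinates — satisfies
`Var(Z_{v,1} ∣ π, L) ≤ C·Δ^{1.4}`, the conditional variance being over the random vertex
partition. -/
theorem good_vertices_small_variance :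
    ∃ C : ℝ, 0 < C ∧
      ∀ (V : Type u) [Fintype V] [DecidableEq V]
        (E : Finset (Sym2 V)) (_ : ∀ e ∈ E, ¬ e.IsDiag)
        (Δ : ℕ) (_ : ∀ v : V, (E.filter fun e => v ∈ e).card ≤ Δ) (_ : 1 ≤ Δ)
        (p : ℝ) (_ : p = (Δ : ℝ) ^ (-(0.85 : ℝ)))
        (k : ℕ) (_ : (k : ℝ) = (Δ : ℝ) ^ ((0.1 : ℝ))) (_ : 0 < k)
        (π : Sym2 V → ℕ) (_ : Set.InjOn π ↑E)
        (L : Finset (Sym2 V)) (_ : L ⊆ E) (v : V)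
        (_ : ∑ x : V → Bool, bwX (1 / (k : ℝ)) x * (Bqueries E π L x v : ℝ) ≤
              (Δ : ℝ) ^ ((1.4 : ℝ))),
        ∑ x : V → Bool, bwX (1 / (k : ℝ)) x *
            ((Zv1 E π L x v : ℝ) -
              ∑ x' : V → Bool, bwX (1 / (k : ℝ)) x' * (Zv1 E π L x' v : ℝ)) ^ 2 ≤
          C * (Δ : ℝ) ^ ((1.4 : ℝ)) := by
  refine ⟨4, by norm_num, ?_⟩
  intro V _ _ E hdiag Δ _ _ p _ k _ hk π hinj L hL v hgood
  have h0 : (0 : ℝ) ≤ 1 / (k : ℝ) := by positivity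
  have h1 : 1 / (k : ℝ) ≤ 1 := by
    rw [div_le_one (by exact_mod_cast hk)]
    exact_mod_cast hk
  exact (bernoulliExp_variance_Zv1_le E hdiag π hinj L hL h0 h1 v).trans
    (mul_le_mul_of_nonneg_left hgood (by norm_num))
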